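/- Let S be an inverse semigroup with an upward directed set of idempotents E. If the group S/≈ is infinite, then the Banach algebra ℓ¹(S) is not biprojective. -/

import Mathlib

noncomputable section

open scoped Topology

universe u u₁ u₂ u₃ v w

/-- The smallest closed two-sided ideal (realized as a `ℂ`-submodule which is topologically
closed and stable under multiplication by arbitrary elements) containing a given set. -/
def closedIdealGen {R : Type u} [NonUnitalNormedRing R] [NormedSpace ℂ R] (s : Set R) :
    Submodule ℂ R :=
  sInf {p : Submodule ℂ R |
    s ⊆ (p : Set R) ∧ IsClosed (p : Set R) ∧ ∀ x ∈ p, ∀ y : R, x * y ∈ p ∧ y * x ∈ p}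

/-- Data exhibiting the Banach space `TB` as the projective tensor product `B ⊗̂ B` of a
Banach algebra `B` with itself. -/
structure TensorSquareSetting (B : Type u) (TB : Type v)
    [NonUnitalNormedRing B] [NormedSpace ℂ B] [CompleteSpace B]
    [NonUnitalNormedRing TB] [NormedSpace ℂ TB] [CompleteSpace TB] where
  tp : B → B → TB
  tp_add_left : ∀ a b c, tp (a + b) c = tp a c + tp b c
  tp_add_right : ∀ a b c, tp a (b + c) = tp a b + tp a c
  tp_smul_left : ∀ (z : ℂ) a b, tp (z • a) b = z • tp a b
  tp_smul_right : ∀ (z : ℂ) a b, tp a (z • b) = z • tp a b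
  tp_norm : ∀ a b, ‖tp a b‖ ≤ ‖a‖ * ‖b‖
  tp_mul : ∀ a b c d, tp a b * tp c d = tp (a * c) (b * d)
  tp_dense :
    Dense ((Submodule.span ℂ (Set.range fun p : B × B => tp p.1 p.2) : Submodule ℂ TB) : Set TB)
  tp_universal : ∀ {X : Type w} [NormedAddCommGroup X] [NormedSpace ℂ X] [CompleteSpace X]
      (φ : B →L[ℂ] B →L[ℂ] X),
      ∃ ψ : TB →L[ℂ] X, ‖ψ‖ ≤ ‖φ‖ ∧ ∀ a b, ψ (tp a b) = φ a b
  lmul : B → TB →L[ℂ] TB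
  rmul : B → TB →L[ℂ] TB
  lmul_tp : ∀ a b c, lmul a (tp b c) = tp (a * b) c
  rmul_tp : ∀ a b c, rmul a (tp b c) = tp b (c * a)
  ω : TB →L[ℂ] B
  ω_tp : ∀ a b, ω (tp a b) = a * b

/-- A Banach algebra `B` is biprojective if the multiplication map
`ω : B ⊗̂ B → B` has a bounded right inverse which is a `B`-bimodule homomorphism. -/
def TensorSquareSetting.Biprojective {B : Type u} {TB : Type v}
    [NonUnitalNormedRing B] [NormedSpace ℂ B] [CompleteSpace B]
    [NonUnitalNormedRing TB] [NormedSpace ℂ TB] [CompleteSpace TB]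
    (ts : TensorSquareSetting B TB) : Prop :=
  ∃ ρ : B →L[ℂ] TB,
    (∀ a b, ρ (a * b) = ts.lmul a (ρ b)) ∧
    (∀ a b, ρ (b * a) = ts.rmul a (ρ b)) ∧
    (∀ a, ts.ω (ρ a) = a)

/-- A Banach algebra `B` is biflat if the adjoint `ω* : B* → (B ⊗̂ B)*` of the multiplication
map has a bounded left inverse which is a `B`-bimodule homomorphism (for the dual actions
`a · f = f(· a)` and `f · a = f(a ·)`). -/
def TensorSquareSetting.Biflat {B : Type u} {TB : Type v}
    [NonUnitalNormedRing B] [NormedSpace ℂ B] [CompleteSpace B]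
    [NonUnitalNormedRing TB] [NormedSpace ℂ TB] [CompleteSpace TB]
    [IsScalarTower ℂ B B] [SMulCommClass ℂ B B]
    (ts : TensorSquareSetting B TB) : Prop :=
  ∃ θ : (TB →L[ℂ] ℂ) →L[ℂ] (B →L[ℂ] ℂ),
    (∀ (a : B) (f : TB →L[ℂ] ℂ),
      θ (f.comp (ts.rmul a)) = (θ f).comp ((ContinuousLinearMap.mul ℂ B).flip a)) ∧
    (∀ (a : B) (f : TB →L[ℂ] ℂ),
      θ (f.comp (ts.lmul a)) = (θ f).comp (ContinuousLinearMap.mul ℂ B a)) ∧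
    (∀ g : B →L[ℂ] ℂ, θ (g.comp ts.ω) = g)

/-- Compatible bounded bimodule actions of a Banach algebra `𝔄` on a Banach algebra `𝒜`:
`lsmul α a = α · a` and `rsmul α a = a · α`, with `α · (a b) = (α · a) b` and
`(a b) · α = a (b · α)`. -/
structure ActionSetting (𝔄 : Type u₁) (𝒜 : Type u)
    [NonUnitalNormedRing 𝔄] [NormedSpace ℂ 𝔄] [CompleteSpace 𝔄]
    [NonUnitalNormedRing 𝒜] [NormedSpace ℂ 𝒜] [CompleteSpace 𝒜] where
  lsmul : 𝔄 → 𝒜 →L[ℂ] 𝒜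
  rsmul : 𝔄 → 𝒜 →L[ℂ] 𝒜
  lsmul_add : ∀ α β, lsmul (α + β) = lsmul α + lsmul β
  lsmul_smulc : ∀ (z : ℂ) α, lsmul (z • α) = z • lsmul α
  rsmul_add : ∀ α β, rsmul (α + β) = rsmul α + rsmul β
  rsmul_smulc : ∀ (z : ℂ) α, rsmul (z • α) = z • rsmul α
  lsmul_bound : ∃ C : ℝ, ∀ α, ‖lsmul α‖ ≤ C * ‖α‖
  rsmul_bound : ∃ C : ℝ, ∀ α, ‖rsmul α‖ ≤ C * ‖α‖
  lsmul_mulA : ∀ α β a, lsmul (α * β) a = lsmul α (lsmul β a)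
  rsmul_mulA : ∀ α β a, rsmul (α * β) a = rsmul β (rsmul α a)
  lsmul_rsmul : ∀ α β a, rsmul β (lsmul α a) = lsmul α (rsmul β a)
  lsmul_compat : ∀ α a b, lsmul α (a * b) = lsmul α a * b
  rsmul_compat : ∀ α a b, rsmul α (a * b) = a * rsmul α b

/-- The full setting of the paper: `𝒜` is a Banach algebra with compatible `𝔄`-actions,
`T = 𝒜 ⊗̂ 𝒜` is its projective tensor square carrying the induced `𝔄`-actions
(`tlsmul α (a ⊗ b) = (α·a) ⊗ b`, `trsmul α (a ⊗ b) = a ⊗ (b·α)`), `I ⊆ T` is the closed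
ideal generated by the elements `α·a ⊗ b - a ⊗ b·α`, `J ⊆ 𝒜` is the closed ideal generated
by `ω(I)`, and the induced bounded operators on the quotient Banach spaces
`T ⧸ I = 𝒜 ⊗̂_𝔄 𝒜` and `𝒜 ⧸ J` are recorded: `qω` is the induced multiplication map `ω̃`,
`qlsmul/qrsmul` (resp. `qtlsmul/qtrsmul`) are the induced `𝔄`-actions on `𝒜 ⧸ J`
(resp. `T ⧸ I`), and `qmulL/qmulR` (resp. `qlmul/qrmul`) are the induced `𝒜`- (hence
`𝒜/J`-) bimodule actions on `𝒜 ⧸ J` (resp. `T ⧸ I`). -/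
structure ModuleSetting (𝔄 : Type u₁) (𝒜 : Type u) (T : Type v)
    [NonUnitalNormedRing 𝔄] [NormedSpace ℂ 𝔄] [CompleteSpace 𝔄]
    [NonUnitalNormedRing 𝒜] [NormedSpace ℂ 𝒜] [CompleteSpace 𝒜]
    [NonUnitalNormedRing T] [NormedSpace ℂ T] [CompleteSpace T] extends
    TensorSquareSetting 𝒜 T, ActionSetting 𝔄 𝒜 where
  tlsmul : 𝔄 → T →L[ℂ] T
  trsmul : 𝔄 → T →L[ℂ] T
  tlsmul_tp : ∀ α a b, tlsmul α (tp a b) = tp (lsmul α a) b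
  trsmul_tp : ∀ α a b, trsmul α (tp a b) = tp a (rsmul α b)
  I : Submodule ℂ T
  J : Submodule ℂ 𝒜
  hI : I = closedIdealGen
    {x : T | ∃ (α : 𝔄) (a b : 𝒜), x = tlsmul α (tp a b) - trsmul α (tp a b)}
  hJ : J = closedIdealGen (ω '' I)
  qω : (T ⧸ I) →L[ℂ] (𝒜 ⧸ J)
  qω_mk : ∀ t, qω (Submodule.Quotient.mk t) = Submodule.Quotient.mk (ω t)
  qlsmul : 𝔄 → (𝒜 ⧸ J) →L[ℂ] (𝒜 ⧸ J)
  qrsmul : 𝔄 → (𝒜 ⧸ J) →L[ℂ] (𝒜 ⧸ J)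
  qlsmul_mk : ∀ α a, qlsmul α (Submodule.Quotient.mk a) = Submodule.Quotient.mk (lsmul α a)
  qrsmul_mk : ∀ α a, qrsmul α (Submodule.Quotient.mk a) = Submodule.Quotient.mk (rsmul α a)
  qmulL : 𝒜 → (𝒜 ⧸ J) →L[ℂ] (𝒜 ⧸ J)
  qmulR : 𝒜 → (𝒜 ⧸ J) →L[ℂ] (𝒜 ⧸ J)
  qmulL_mk : ∀ a b, qmulL a (Submodule.Quotient.mk b) = Submodule.Quotient.mk (a * b)
  qmulR_mk : ∀ a b, qmulR a (Submodule.Quotient.mk b) = Submodule.Quotient.mk (b * a)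
  qtlsmul : 𝔄 → (T ⧸ I) →L[ℂ] (T ⧸ I)
  qtrsmul : 𝔄 → (T ⧸ I) →L[ℂ] (T ⧸ I)
  qtlsmul_mk : ∀ α t, qtlsmul α (Submodule.Quotient.mk t) = Submodule.Quotient.mk (tlsmul α t)
  qtrsmul_mk : ∀ α t, qtrsmul α (Submodule.Quotient.mk t) = Submodule.Quotient.mk (trsmul α t)
  qlmul : 𝒜 → (T ⧸ I) →L[ℂ] (T ⧸ I)
  qrmul : 𝒜 → (T ⧸ I) →L[ℂ] (T ⧸ I)
  qlmul_mk : ∀ a t, qlmul a (Submodule.Quotient.mk t) = Submodule.Quotient.mk (lmul a t)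
  qrmul_mk : ∀ a t, qrmul a (Submodule.Quotient.mk t) = Submodule.Quotient.mk (rmul a t)

namespace ModuleSetting

variable {𝔄 : Type u₁} {𝒜 : Type u} {T : Type v}
    [NonUnitalNormedRing 𝔄] [NormedSpace ℂ 𝔄] [CompleteSpace 𝔄]
    [NonUnitalNormedRing 𝒜] [NormedSpace ℂ 𝒜] [CompleteSpace 𝒜]
    [NonUnitalNormedRing T] [NormedSpace ℂ T] [CompleteSpace T]

/-- `𝒜` is module biprojective (as an `𝔄`-module) if the induced multiplication map
`ω̃ : 𝒜 ⊗̂_𝔄 𝒜 → 𝒜 ⧸ J` has a bounded right inverse which is an `𝒜/J`-`𝔄`-module morphism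
(a bounded additive map commuting with the `𝔄`-actions and the `𝒜/J`-bimodule actions). -/
def ModuleBiprojective (S : ModuleSetting 𝔄 𝒜 T) : Prop :=
  ∃ ρ : (𝒜 ⧸ S.J) → (T ⧸ S.I),
    (∀ x y, ρ (x + y) = ρ x + ρ y) ∧
    (∃ C : ℝ, ∀ x, ‖ρ x‖ ≤ C * ‖x‖) ∧
    (∀ α x, ρ (S.qlsmul α x) = S.qtlsmul α (ρ x)) ∧
    (∀ α x, ρ (S.qrsmul α x) = S.qtrsmul α (ρ x)) ∧
    (∀ a x, ρ (S.qmulL a x) = S.qlmul a (ρ x)) ∧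
    (∀ a x, ρ (S.qmulR a x) = S.qrmul a (ρ x)) ∧
    (∀ x, S.qω (ρ x) = x)

/-- `𝒜` is module biflat (as an `𝔄`-module) if the adjoint
`ω̃* : (𝒜 ⧸ J)* → (𝒜 ⊗̂_𝔄 𝒜)*` has a bounded left inverse which is an `𝒜/J`-`𝔄`-module
morphism (for the dual actions). -/
def ModuleBiflat (S : ModuleSetting 𝔄 𝒜 T) : Prop :=
  ∃ θ : ((T ⧸ S.I) →L[ℂ] ℂ) → ((𝒜 ⧸ S.J) →L[ℂ] ℂ),
    (∀ f g, θ (f + g) = θ f + θ g) ∧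
    (∃ C : ℝ, ∀ f, ‖θ f‖ ≤ C * ‖f‖) ∧
    (∀ α f, θ (f.comp (S.qtrsmul α)) = (θ f).comp (S.qrsmul α)) ∧
    (∀ α f, θ (f.comp (S.qtlsmul α)) = (θ f).comp (S.qlsmul α)) ∧
    (∀ a f, θ (f.comp (S.qrmul a)) = (θ f).comp (S.qmulR a)) ∧
    (∀ a f, θ (f.comp (S.qlmul a)) = (θ f).comp (S.qmulL a)) ∧
    (∀ g : (𝒜 ⧸ S.J) →L[ℂ] ℂ, θ (g.comp S.qω) = g)

/-- `𝔄` acts trivially on `𝒜` from the left, via the continuous functional `f`: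
`α · a = f(α) a`. -/
def TrivialLeftAction (S : ModuleSetting 𝔄 𝒜 T) (f : 𝔄 →L[ℂ] ℂ) : Prop :=
  ∀ α a, S.lsmul α a = f α • a

/-- The quotient algebra `𝒜 ⧸ J` has a left identity `e + J`. -/
def HasLeftIdentity (S : ModuleSetting 𝔄 𝒜 T) : Prop :=
  ∃ e : 𝒜, ∀ x : 𝒜 ⧸ S.J, S.qmulL e x = x

/-- The quotient algebra `𝒜 ⧸ J` has an identity `e + J`. -/
def HasIdentity (S : ModuleSetting 𝔄 𝒜 T) : Prop :=
  ∃ e : 𝒜, ∀ x : 𝒜 ⧸ S.J, S.qmulL e x = x ∧ S.qmulR e x = x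

/-- `𝔄` has a bounded approximate identity for `𝒜`: a bounded net `(α_j)` in `𝔄` with
`‖α_j · a - a‖ → 0` and `‖a · α_j - a‖ → 0` for every `a ∈ 𝒜`. -/
def HasBoundedApproximateIdentityFor (S : ModuleSetting 𝔄 𝒜 T) : Prop :=
  ∃ C : ℝ, 0 < C ∧ ∀ ε : ℝ, 0 < ε → ∀ F : Finset 𝒜, ∃ α : 𝔄, ‖α‖ ≤ C ∧
    ∀ a ∈ F, ‖S.lsmul α a - a‖ < ε ∧ ‖S.rsmul α a - a‖ < ε

/-- The quotient algebra `𝒜 ⧸ J` has a bounded approximate identity. -/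
def QuotientHasBoundedApproximateIdentity (S : ModuleSetting 𝔄 𝒜 T) : Prop :=
  ∃ C : ℝ, 0 < C ∧ ∀ ε : ℝ, 0 < ε → ∀ F : Finset (𝒜 ⧸ S.J), ∃ e : 𝒜,
    ‖(Submodule.Quotient.mk e : 𝒜 ⧸ S.J)‖ ≤ C ∧
    ∀ x ∈ F, ‖S.qmulL e x - x‖ < ε ∧ ‖S.qmulR e x - x‖ < ε

/-- `𝒜 ⧸ J` is a commutative `𝔄`-module. -/
def QuotientCommutative (S : ModuleSetting 𝔄 𝒜 T) : Prop :=
  ∀ (α : 𝔄) (x : 𝒜 ⧸ S.J), S.qlsmul α x = S.qrsmul α x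

end ModuleSetting

/-- `δ : S → A` exhibits the Banach algebra `A` as the semigroup algebra `ℓ¹(S)` of the
discrete semigroup `S`: the point masses `δ s` multiply via convolution
(`δ s * δ t = δ (s t)`), finite linear combinations of point masses are isometrically
`ℓ¹`-normed, and their span is dense. -/
structure IsL1Algebra (S : Type u₂) [Semigroup S] (A : Type u)
    [NonUnitalNormedRing A] [NormedSpace ℂ A] [CompleteSpace A] (δ : S → A) : Prop where
  delta_mul : ∀ s t : S, δ s * δ t = δ (s * t)
  norm_combo : ∀ c : S →₀ ℂ, ‖c.sum fun s z => z • δ s‖ = c.sum fun _ z => ‖z‖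
  dense_span : Dense ((Submodule.span ℂ (Set.range δ) : Submodule ℂ A) : Set A)

/-- `S` is an inverse semigroup: every element has a unique generalized inverse. -/
def IsInverseSemigroup (S : Type u₂) [Semigroup S] : Prop :=
  ∀ s : S, ∃! t : S, s * t * s = s ∧ t * s * t = t

/-- The set of idempotents of `S` is upward directed: for all idempotents `e, f` there is
an idempotent `g` with `e g = e` and `f g = f`. -/
def UpwardDirectedIdempotents (S : Type u₂) [Semigroup S] : Prop :=
  ∀ e f : S, e * e = e → f * f = f → ∃ g : S, g * g = g ∧ e * g = e ∧ f * g = f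

/-- A discrete semigroup `S` is amenable if there is a mean `m` on `ℓ^∞(S)` (a functional
with `‖m‖ = m(1) = 1`) which is both left and right invariant under translations. -/
def AmenableSemigroup (S : Type u₂) [Semigroup S] [TopologicalSpace S] [DiscreteTopology S] :
    Prop :=
  ∃ m : BoundedContinuousFunction S ℂ →L[ℂ] ℂ, ‖m‖ = 1 ∧ m 1 = 1 ∧
    ∀ (a : S) (f : BoundedContinuousFunction S ℂ),
      m (f.compContinuous ⟨fun s => a * s, continuous_of_discreteTopology⟩) = m f ∧
      m (f.compContinuous ⟨fun s => s * a, continuous_of_discreteTopology⟩) = m f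

section InverseSemigroup

variable {S : Type*} [Semigroup S]

theorem IsInverseSemigroup.mul_idempotent (hinv : IsInverseSemigroup S) {e f : S}
    (he : e * e = e) (hf : f * f = f) : (e * f) * (e * f) = e * f := by
  obtain ⟨x, ⟨h1, h2⟩, hx⟩ := hinv (e * f)
  have hfxe : f * x * e = x := by
    refine hx _ ⟨?_, ?_⟩
    · calc e * f * (f * x * e) * (e * f) = e * (f * f) * x * (e * e) * f := by
            simp only [mul_assoc]
        _ = e * f * x * (e * f) := by rw [he, hf]; simp only [mul_assoc]
        _ = e * f := h1
    · calc f * x * e * (e * f) * (f * x * e) = f * x * (e * e) * (f * f) * x * e := by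
            simp only [mul_assoc]
        _ = f * (x * (e * f) * x) * e := by rw [he, hf]; simp only [mul_assoc]
        _ = f * x * e := by rw [h2]
  have hxx : x * x = x := by
    calc x * x = f * x * e * (f * x * e) := by rw [hfxe]
      _ = f * (x * (e * f) * x) * e := by simp only [mul_assoc]
      _ = x := by rw [h2, hfxe]
  have hxxx : x * x * x = x := by rw [hxx, hxx]
  have : e * f = x := (hinv x).unique ⟨h2, h1⟩ ⟨hxxx, hxxx⟩
  rw [this, hxx]

theorem IsInverseSemigroup.idempotent_comm (hinv : IsInverseSemigroup S) {e f : S}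
    (he : e * e = e) (hf : f * f = f) : e * f = f * e := by
  have h1 := hinv.mul_idempotent he hf
  have h2 := hinv.mul_idempotent hf he
  refine (hinv (e * f)).unique ⟨by rw [h1, h1], by rw [h1, h1]⟩ ⟨?_, ?_⟩
  · calc e * f * (f * e) * (e * f) = e * (f * f) * (e * e) * f := by simp only [mul_assoc]
      _ = e * f * (e * f) := by rw [he, hf]; simp only [mul_assoc]
      _ = e * f := h1
  · calc f * e * (e * f) * (f * e) = f * (e * e) * (f * f) * e := by simp only [mul_assoc]
      _ = f * e * (f * e) := by rw [he, hf]; simp only [mul_assoc]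
      _ = f * e := h2

/-- In an inverse semigroup, a left congruence identifying `s` with `s * e` for every
idempotent `e` has the left translation property of congruences with group quotient. -/
theorem IsInverseSemigroup.exists_translation (hinv : IsInverseSemigroup S) {r : S → S → Prop}
    (hr : Equivalence r) (hmul : ∀ u s t, r s t → r (u * s) (u * t))
    (hid : ∀ s e, e * e = e → r s (s * e)) (s t : S) :
    ∃ u, ∀ x, r (u * x) s ↔ r x t := by
  obtain ⟨s', ⟨hs, hs'⟩, -⟩ := hinv s
  obtain ⟨t', ⟨ht, ht'⟩, -⟩ := hinv t
  have idem_left : ∀ {a b : S}, a * b * a = a → a * b * (a * b) = a * b := fun h => by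
    rw [← mul_assoc, h]
  have ets : t' * t * (t' * t) = t' * t := idem_left ht'
  have ess : s' * s * (s' * s) = s' * s := idem_left hs'
  refine ⟨s * t', fun x => ⟨fun h => ?_, fun h => ?_⟩⟩
  · obtain ⟨x', ⟨hx, hx'⟩, -⟩ := hinv x
    have exx : x * x' * (x * x') = x * x' := idem_left hx
    have hcomm := hinv.idempotent_comm ess ets
    set p := t * s' * (s * t') with hp
    have pp : p * p = p := by
      calc p * p = t * ((s' * s) * (t' * t)) * (s' * s) * t' := by
            simp only [hp, mul_assoc]
        _ = t * (t' * t) * ((s' * s) * (s' * s)) * t' := by rw [hcomm]; simp only [mul_assoc]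
        _ = (t * t' * t) * (s' * s) * t' := by rw [ess]; simp only [mul_assoc]
        _ = p := by rw [ht]; simp only [hp, mul_assoc]
    have key : x * (x' * p * x) = p * x := by
      calc x * (x' * p * x) = x * x' * p * x := by simp only [mul_assoc]
        _ = p * (x * x' * x) := by
            rw [hinv.idempotent_comm exx pp]; simp only [mul_assoc]
        _ = p * x := by rw [hx]
    have hidem : x' * p * x * (x' * p * x) = x' * p * x := by
      calc x' * p * x * (x' * p * x) = x' * p * (x * (x' * p * x)) := by simp only [mul_assoc]
        _ = x' * (p * p) * x := by rw [key]; simp only [mul_assoc]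
        _ = x' * p * x := by rw [pp]
    have h1 : r x (p * x) := key ▸ hid x _ hidem
    have h2 : r (p * x) (t * (s' * s)) := by
      simpa only [hp, mul_assoc] using hmul (t * s') _ _ h
    exact hr.trans h1 (hr.trans h2 (hr.symm (hid t _ ess)))
  · have h1 := hmul (s * t') _ _ h
    rw [mul_assoc s t' t] at h1
    exact hr.trans h1 (hr.symm (hid s _ ets))

end InverseSemigroup

/-- An equivalence relation on a set admits only finitely many classes if there is a normalized,
finitely additive, tight set function which takes equal values on all classes. -/
theorem finite_quot_of_tight_charge {S : Type*} (r : Setoid S) (μ : Set S → ℂ)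
    (hadd : ∀ C D, Disjoint C D → μ (C ∪ D) = μ C + μ D) (huniv : μ Set.univ = 1)
    (htight : ∀ ε : ℝ, 0 < ε → ∃ F : Finset S, ∀ C : Set S, Disjoint C ↑F → ‖μ C‖ ≤ ε)
    (hclass : ∀ s t, μ {x | r x s} = μ {x | r x t}) : Finite (Quotient r) := by
  classical
  by_contra hfin
  rw [not_finite_iff_infinite] at hfin
  have hzero : ∀ s, μ {x | r x s} = 0 := by
    intro s
    rw [← norm_le_zero_iff]
    refine le_of_forall_pos_le_add fun ε hε => ?_
    obtain ⟨F, hF⟩ := htight ε hε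
    obtain ⟨c, hc⟩ := Infinite.exists_notMem_finset (F.image (Quotient.mk r))
    obtain ⟨t, rfl⟩ := Quotient.exists_rep c
    rw [hclass s t, zero_add]
    refine hF _ (Set.disjoint_left.2 fun x hx hxF => hc ?_)
    exact Finset.mem_image.2 ⟨x, hxF, Quotient.sound hx⟩
  have hempty : μ ∅ = 0 := by simpa using hadd ∅ ∅ (by simp)
  have hfinset : ∀ T : Finset (Quotient r), μ (Quotient.mk r ⁻¹' (T : Set (Quotient r))) = 0 := by
    intro T
    induction T using Finset.induction_on with
    | empty => simpa using hempty
    | insert c T hc ih =>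
      obtain ⟨t, rfl⟩ := Quotient.exists_rep c
      have h1 : Quotient.mk r ⁻¹' {Quotient.mk r t} = {x | r x t} := by
        ext x
        exact Quotient.eq
      rw [Finset.coe_insert, Set.insert_eq, Set.preimage_union, hadd, ih, h1, hzero, add_zero]
      exact Disjoint.preimage _ (by simpa using hc)
  obtain ⟨F, hF⟩ := htight (1 / 2) (by norm_num)
  set D := Quotient.mk r ⁻¹' ((F.image (Quotient.mk r) : Finset _) : Set (Quotient r)) with hD
  have hDc : ‖μ Dᶜ‖ ≤ 1 / 2 := hF _ (Set.disjoint_left.2 fun x hx hxF => hx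
    (by simpa [hD] using ⟨x, hxF, rfl⟩))
  have hsum := hadd D Dᶜ disjoint_compl_right
  rw [Set.union_compl_self, huniv, hfinset, zero_add] at hsum
  rw [← hsum] at hDc
  norm_num at hDc

section L1

variable {S : Type*} [Semigroup S] {A : Type u} [NonUnitalNormedRing A] [NormedSpace ℂ A]
  [CompleteSpace A] {δ : S → A}

/-- A function on `S` bounded by one extends to a contractive functional on `ℓ¹(S)`. -/
theorem IsL1Algebra.exists_functional (hA : IsL1Algebra S A δ) (h : S → ℂ)
    (hh : ∀ s, ‖h s‖ ≤ 1) : ∃ f : A →L[ℂ] ℂ, ‖f‖ ≤ 1 ∧ ∀ s, f (δ s) = h s := by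
  let T : (S →₀ ℂ) →ₗ[ℂ] A := Finsupp.linearCombination ℂ δ
  have hT : ∀ c, ‖T c‖ = c.sum fun _ z => ‖z‖ := hA.norm_combo
  have hinj : Function.Injective T := by
    rw [injective_iff_map_eq_zero]
    intro c hc
    have hsum := hT c
    rw [hc, norm_zero, Finsupp.sum, eq_comm,
      Finset.sum_eq_zero_iff_of_nonneg fun _ _ => norm_nonneg _] at hsum
    ext s
    by_contra hs
    exact hs (norm_eq_zero.1 (hsum s (Finsupp.mem_support_iff.2 hs)))
  let e := LinearEquiv.ofInjective T hinj
  let g : LinearMap.range T →ₗ[ℂ] ℂ := (Finsupp.linearCombination ℂ h).comp e.symm.toLinearMap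
  have hge : ∀ c, g (e c) = Finsupp.linearCombination ℂ h c := fun c => by simp [g]
  have hg : ∀ x, ‖g x‖ ≤ 1 * ‖x‖ := by
    intro x
    obtain ⟨c, rfl⟩ := e.surjective x
    have hec : ‖e c‖ = c.sum fun _ z => ‖z‖ := hT c
    rw [hge, hec, one_mul, Finsupp.linearCombination_apply]
    refine (norm_sum_le _ _).trans (Finset.sum_le_sum fun s _ => ?_)
    rw [norm_smul]
    exact mul_le_of_le_one_right (norm_nonneg _) (hh s)
  obtain ⟨f, hf, hfn⟩ := exists_extension_norm_eq (LinearMap.range T) (g.mkContinuous 1 hg)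
  refine ⟨f, hfn ▸ LinearMap.mkContinuous_norm_le _ zero_le_one _, fun s => ?_⟩
  have hes : (e (Finsupp.single s 1) : A) = δ s := by
    simp [e, T]
  rw [← hes, hf, LinearMap.mkContinuous_apply, hge]
  simp

theorem IsL1Algebra.ext (hA : IsL1Algebra S A δ) {X : Type*} [AddCommMonoid X] [Module ℂ X]
    [TopologicalSpace X] [T2Space X] {f g : A →L[ℂ] X} (h : ∀ s, f (δ s) = g (δ s)) : f = g :=
  ContinuousLinearMap.ext_on hA.dense_span (by rintro _ ⟨s, rfl⟩; exact h s)

end L1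

namespace TensorSquareSetting

variable {B : Type u} {TB : Type v}
    [NonUnitalNormedRing B] [NormedSpace ℂ B] [CompleteSpace B]
    [NonUnitalNormedRing TB] [NormedSpace ℂ TB] [CompleteSpace TB]

theorem isScalarTower (ts : TensorSquareSetting.{u, v, w} B TB) : IsScalarTower ℂ B B :=
  ⟨fun z a b => by
    rw [smul_eq_mul, smul_eq_mul, ← ts.ω_tp, ← ts.ω_tp, ts.tp_smul_left, map_smul]⟩

theorem smulCommClass (ts : TensorSquareSetting.{u, v, w} B TB) : SMulCommClass ℂ B B :=
  ⟨fun z a b => by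
    rw [smul_eq_mul, smul_eq_mul, ← ts.ω_tp, ← ts.ω_tp, ts.tp_smul_right, map_smul]⟩

theorem ext (ts : TensorSquareSetting.{u, v, w} B TB) {X : Type*} [AddCommMonoid X] [Module ℂ X]
    [TopologicalSpace X] [T2Space X] {f g : TB →L[ℂ] X}
    (h : ∀ a b, f (ts.tp a b) = g (ts.tp a b)) : f = g :=
  ContinuousLinearMap.ext_on ts.tp_dense (by rintro _ ⟨p, rfl⟩; exact h p.1 p.2)

/-- The tensor product of two functionals. -/
theorem exists_functional (ts : TensorSquareSetting.{u, v, w} B TB) (f g : B →L[ℂ] ℂ) :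
    ∃ Λ : TB →L[ℂ] ℂ, ‖Λ‖ ≤ ‖f‖ * ‖g‖ ∧ ∀ a b, Λ (ts.tp a b) = f a * g b := by
  let up : ℂ →L[ℂ] ULift.{w} ℂ :=
    ULift.moduleEquiv.symm.toLinearMap.mkContinuous 1 fun z => by
      rw [one_mul]; exact le_rfl
  let down : ULift.{w} ℂ →L[ℂ] ℂ :=
    ULift.moduleEquiv.toLinearMap.mkContinuous 1 fun z => by
      rw [one_mul]; exact le_rfl
  obtain ⟨ψ, hψ, hψt⟩ := ts.tp_universal (f.smulRight (up.comp g))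
  refine ⟨down.comp ψ, ?_, fun a b => ?_⟩
  · calc ‖down.comp ψ‖ ≤ ‖down‖ * ‖ψ‖ := ContinuousLinearMap.opNorm_comp_le _ _
      _ ≤ 1 * (‖f‖ * ‖g‖) := by
        refine mul_le_mul (LinearMap.mkContinuous_norm_le _ zero_le_one _) (hψ.trans ?_)
          (norm_nonneg _) zero_le_one
        rw [ContinuousLinearMap.norm_smulRight_apply]
        refine mul_le_mul_of_nonneg_left ?_ (norm_nonneg _)
        refine (ContinuousLinearMap.opNorm_comp_le _ _).trans ?_
        exact mul_le_of_le_one_left (norm_nonneg _)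
          (LinearMap.mkContinuous_norm_le _ zero_le_one _)
      _ = ‖f‖ * ‖g‖ := one_mul _
  · rw [ContinuousLinearMap.comp_apply, hψt]
    simp [up, down]

/-- Elementary tensors whose left leg is a point mass span a dense subspace. -/
theorem dense_span_delta {S : Type*} [Semigroup S] {δ : S → B}
    (ts : TensorSquareSetting.{u, v, w} B TB) (hB : IsL1Algebra S B δ) :
    Dense ((Submodule.span ℂ (Set.range fun p : S × B => ts.tp (δ p.1) p.2) :
      Submodule ℂ TB) : Set TB) := by
  set P := Submodule.span ℂ (Set.range fun p : S × B => ts.tp (δ p.1) p.2)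
  have hmem : ∀ a b, ts.tp a b ∈ P.topologicalClosure := by
    intro a b
    let L : B →ₗ[ℂ] TB :=
      { toFun := fun a => ts.tp a b
        map_add' := fun a c => ts.tp_add_left a c b
        map_smul' := fun z a => ts.tp_smul_left z a b }
    let L' : B →L[ℂ] TB := L.mkContinuous ‖b‖ fun a => by
      rw [mul_comm]; exact ts.tp_norm a b
    have hspan : Submodule.span ℂ (Set.range δ) ≤ P.topologicalClosure.comap L := by
      rw [Submodule.span_le]
      rintro _ ⟨s, rfl⟩
      exact P.le_topologicalClosure (Submodule.subset_span ⟨(s, b), rfl⟩)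
    have hclosed : IsClosed (L' ⁻¹' (P.topologicalClosure : Set TB)) :=
      P.isClosed_topologicalClosure.preimage L'.continuous
    exact hclosed.closure_subset_iff.2 hspan (hB.dense_span a)
  have hle : Submodule.span ℂ (Set.range fun p : B × B => ts.tp p.1 p.2) ≤
      P.topologicalClosure := by
    rw [Submodule.span_le]
    rintro _ ⟨p, rfl⟩
    exact hmem p.1 p.2
  have hd := ts.tp_dense.mono (show _ ⊆ (P.topologicalClosure : Set TB) from hle)
  rw [Submodule.topologicalClosure_coe] at hd
  exact dense_closure.1 hd

end TensorSquareSetting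

/-- If `ℓ¹(S)` is biprojective for an inverse semigroup `S`, then every left congruence on `S`
which identifies `s` with `s * e` for all idempotents `e` has finitely many classes. -/
theorem TensorSquareSetting.Biprojective.finite_quotient {S : Type*} [Semigroup S]
    {A : Type u} {TA : Type v}
    [NonUnitalNormedRing A] [NormedSpace ℂ A] [CompleteSpace A]
    [NonUnitalNormedRing TA] [NormedSpace ℂ TA] [CompleteSpace TA]
    {ts : TensorSquareSetting.{u, v, w} A TA} (hbi : ts.Biprojective)
    {δ : S → A} (hA : IsL1Algebra S A δ) (hinv : IsInverseSemigroup S) (r : Setoid S)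
    (hmul : ∀ u s t, r s t → r (u * s) (u * t)) (hid : ∀ s e, e * e = e → r s (s * e)) :
    Finite (Quotient r) := by
  classical
  rcases isEmpty_or_nonempty S with hS | ⟨⟨s₀⟩⟩
  · exact Quotient.finite r
  have := ts.isScalarTower
  have := ts.smulCommClass
  obtain ⟨ρ, hρl, hρr, hρω⟩ := hbi
  have hev : ∀ C : Set S, ∃ f : A →L[ℂ] ℂ, ‖f‖ ≤ 1 ∧ ∀ s, f (δ s) = C.indicator 1 s :=
    fun C => hA.exists_functional _ fun s => by
      by_cases hs : s ∈ C <;> simp [hs]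
  choose ev hevn hevδ using hev
  have hΛ : ∀ C : Set S, ∃ Λ : TA →L[ℂ] ℂ, ‖Λ‖ ≤ 1 ∧
      ∀ a b, Λ (ts.tp a b) = ev C a * ev Set.univ b := fun C => by
    obtain ⟨Λ, hn, ht⟩ := ts.exists_functional (ev C) (ev Set.univ)
    exact ⟨Λ, hn.trans (mul_le_one₀ (hevn _) (norm_nonneg _) (hevn _)), ht⟩
  choose Λ hΛn hΛt using hΛ
  have hright : ∀ t b, ev Set.univ (b * δ t) = ev Set.univ b := by
    intro t
    have : (ev Set.univ).comp ((ContinuousLinearMap.mul ℂ A).flip (δ t)) = ev Set.univ :=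
      hA.ext fun s => by simp [hA.delta_mul, hevδ]
    exact fun b => DFunLike.congr_fun this b
  have hleft : ∀ C s a, ev C (δ s * a) = ev ((s * ·) ⁻¹' C) a := by
    intro C s
    have : (ev C).comp (ContinuousLinearMap.mul ℂ A (δ s)) = ev ((s * ·) ⁻¹' C) :=
      hA.ext fun t => by simp [hA.delta_mul, hevδ, Set.indicator_apply]
    exact fun b => DFunLike.congr_fun this b
  have hmult : ∀ a b, ev Set.univ (a * b) = ev Set.univ a * ev Set.univ b := by
    intro a b
    have : (ev Set.univ).comp (ContinuousLinearMap.mul ℂ A a) =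
        ev Set.univ a • ev Set.univ := hA.ext fun t => by simp [hright, hevδ]
    exact DFunLike.congr_fun this b
  have hΛr : ∀ C t x, Λ C (ts.rmul (δ t) x) = Λ C x := by
    intro C t
    have : (Λ C).comp (ts.rmul (δ t)) = Λ C := ts.ext fun a b => by
      simp [ts.rmul_tp, hΛt, hright]
    exact fun x => DFunLike.congr_fun this x
  have hΛl : ∀ C s x, Λ C (ts.lmul (δ s) x) = Λ ((s * ·) ⁻¹' C) x := by
    intro C s
    have : (Λ C).comp (ts.lmul (δ s)) = Λ ((s * ·) ⁻¹' C) := ts.ext fun a b => by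
      simp [ts.lmul_tp, hΛt, hleft]
    exact fun x => DFunLike.congr_fun this x
  have hΛω : ∀ x, Λ Set.univ x = ev Set.univ (ts.ω x) := by
    have : Λ Set.univ = (ev Set.univ).comp ts.ω := ts.ext fun a b => by
      simp [ts.ω_tp, hΛt, hmult]
    exact fun x => DFunLike.congr_fun this x
  have hΛadd : ∀ C D, Disjoint C D → Λ (C ∪ D) = Λ C + Λ D := by
    intro C D hCD
    have : ev (C ∪ D) = ev C + ev D := hA.ext fun s => by
      simp only [hevδ, add_apply, Set.indicator_union_of_disjoint hCD]
    exact ts.ext fun a b => by simp [hΛt, this, add_mul]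
  have hnuL : ∀ C s t, Λ C (ρ (δ (s * t))) = Λ ((s * ·) ⁻¹' C) (ρ (δ t)) := fun C s t => by
    rw [← hA.delta_mul, hρl, hΛl]
  have hnuR : ∀ C s t, Λ C (ρ (δ (s * t))) = Λ C (ρ (δ s)) := fun C s t => by
    rw [← hA.delta_mul, hρr, hΛr]
  have hidem : ∀ s : S, ∃ e f, e * e = e ∧ e * f = s := fun s => by
    obtain ⟨t, ⟨hs, -⟩, -⟩ := hinv s
    exact ⟨s * t, s, by rw [← mul_assoc, hs], hs⟩
  obtain ⟨e, -, he, -⟩ := hidem s₀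
  have hconst : ∀ C s, Λ C (ρ (δ s)) = Λ C (ρ (δ e)) := fun C s => by
    obtain ⟨i, t, hi, rfl⟩ := hidem s
    rw [hnuR, ← hnuR C i e, hinv.idempotent_comm hi he, hnuR]
  refine finite_quot_of_tight_charge r (fun C => Λ C (ρ (δ e))) (fun C D hCD => ?_) ?_ ?_ ?_
  · simp [hΛadd C D hCD]
  · simp [hΛω, hρω, hevδ]
  · intro ε hε
    obtain ⟨y, hy, hdist⟩ := Metric.dense_iff.1 (ts.dense_span_delta hA) (ρ (δ e)) ε hε
    rw [SetLike.mem_coe] at hdist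
    have hsupp : ∃ F : Finset S, ∀ C : Set S, Disjoint C ↑F → Λ C y = 0 := by
      clear hy
      induction hdist using Submodule.span_induction with
      | mem x hx =>
        obtain ⟨p, rfl⟩ := hx
        refine ⟨{p.1}, fun C hC => ?_⟩
        have : p.1 ∉ C := by simpa using hC
        simp [hΛt, hevδ, this]
      | zero => exact ⟨∅, fun C _ => map_zero _⟩
      | add x y _ _ hx hy =>
        obtain ⟨F, hF⟩ := hx
        obtain ⟨F', hF'⟩ := hy
        refine ⟨F ∪ F', fun C hC => ?_⟩
        rw [Finset.coe_union, Set.disjoint_union_right] at hC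
        rw [map_add, hF C hC.1, hF' C hC.2, add_zero]
      | smul z x _ hx =>
        obtain ⟨F, hF⟩ := hx
        exact ⟨F, fun C hC => by rw [map_smul, hF C hC, smul_zero]⟩
    obtain ⟨F, hF⟩ := hsupp
    refine ⟨F, fun C hC => ?_⟩
    calc ‖Λ C (ρ (δ e))‖ = ‖Λ C (ρ (δ e) - y)‖ := by rw [map_sub, hF C hC, sub_zero]
      _ ≤ 1 * ‖ρ (δ e) - y‖ := (Λ C).le_of_opNorm_le (hΛn C) _
      _ ≤ ε := by
        rw [one_mul, ← dist_eq_norm, dist_comm]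
        exact (Metric.mem_ball.1 hy).le
  · intro s t
    obtain ⟨u, hu⟩ := hinv.exists_translation r.iseqv hmul hid s t
    rw [← hconst {x | r x s} (u * e), hnuL]
    congr 2
    ext x
    exact hu x

theorem closedIdealGen_mul_mem {R : Type u} [NonUnitalNormedRing R] [NormedSpace ℂ R] {s : Set R}
    {x : R} (hx : x ∈ closedIdealGen s) (y : R) : y * x ∈ closedIdealGen s := by
  rw [closedIdealGen, Submodule.mem_sInf] at hx ⊢
  exact fun p hp => (hp.2.2 x (hx p hp) y).2

theorem subset_closedIdealGen {R : Type u} [NonUnitalNormedRing R] [NormedSpace ℂ R] (s : Set R) :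
    s ⊆ closedIdealGen s := fun _ hx => by
  rw [closedIdealGen, SetLike.mem_coe, Submodule.mem_sInf]
  exact fun p hp => hp.1 hx

/-- Corollary 4.2.
Let `S` be an inverse semigroup with an upward directed set of idempotents `E`.  If the
quotient group `S/≈` is infinite, then the Banach algebra `ℓ¹(S)` is not biprojective. -/
theorem stmt13 {S E : Type u₂} [Semigroup S] [Semigroup E]
    {A Ae : Type u} {TA : Type v}
    [NonUnitalNormedRing A] [NormedSpace ℂ A] [CompleteSpace A]
    [NonUnitalNormedRing Ae] [NormedSpace ℂ Ae] [CompleteSpace Ae]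
    [NonUnitalNormedRing TA] [NormedSpace ℂ TA] [CompleteSpace TA]
    (hinv : IsInverseSemigroup S) (hdir : UpwardDirectedIdempotents S)
    (ι : E →ₙ* S) (hι : Function.Injective ι)
    (hrange : Set.range ι = {s : S | s * s = s})
    (δ : S → A) (hA : IsL1Algebra S A δ)
    (δE : E → Ae) (hAe : IsL1Algebra E Ae δE)
    (MS : ModuleSetting Ae A TA)
    (f : Ae →L[ℂ] ℂ) (hf : ∀ e : E, f (δE e) = 1) (htriv : MS.TrivialLeftAction f)
    (hr : ∀ (e : E) (s : S), MS.rsmul (δE e) (δ s) = δ (s * ι e))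
    (hinf : Infinite (Quot fun s t : S => δ s - δ t ∈ MS.J)) :
    ¬ MS.toTensorSquareSetting.Biprojective := by
  intro hbi
  let r : Setoid S :=
    { r := fun s t => δ s - δ t ∈ MS.J
      iseqv :=
        { refl := fun s => by rw [sub_self]; exact MS.J.zero_mem
          symm := fun {s t} h => by rw [← neg_sub]; exact MS.J.neg_mem h
          trans := fun {s t u} h h' => by
            rw [← sub_add_sub_cancel (δ s) (δ t) (δ u)]; exact MS.J.add_mem h h' } }
  have hmul : ∀ u s t, r s t → r (u * s) (u * t) := fun u s t h => by
    change δ (u * s) - δ (u * t) ∈ MS.J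
    change δ s - δ t ∈ MS.J at h
    rw [MS.hJ] at h ⊢
    rw [← hA.delta_mul, ← hA.delta_mul, ← mul_sub]
    exact closedIdealGen_mul_mem h _
  have hid : ∀ s e, e * e = e → r s (s * e) := fun s e he => by
    obtain ⟨t, ⟨hs, -⟩, -⟩ := hinv s
    obtain ⟨e, rfl⟩ : e ∈ Set.range ι := by rw [hrange]; exact he
    change δ s - δ (s * ι e) ∈ MS.J
    rw [MS.hJ]
    refine subset_closedIdealGen _ ⟨MS.tlsmul (δE e) (MS.tp (δ (s * t)) (δ s)) -
      MS.trsmul (δE e) (MS.tp (δ (s * t)) (δ s)), ?_, ?_⟩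
    · rw [MS.hI]
      exact subset_closedIdealGen _ ⟨_, _, _, rfl⟩
    · rw [map_sub, MS.tlsmul_tp, MS.trsmul_tp, MS.ω_tp, MS.ω_tp, htriv, hf, one_smul, hr,
        hA.delta_mul, hA.delta_mul, ← mul_assoc, hs]
  have hfin : Finite (Quotient r) := hbi.finite_quotient hA hinv r hmul hid
  exact hinf.not_finite hfin
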